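/- Let N ≥ 1 be an integer, f(z₁,z₂) a polynomial with complex coefficients, and fix radii 0 < ε₁ < ε₂. For every complex number u with |u|·ε₁^N < ε₂^N (in particular for all u ∈ [0,1]), the iterated counterclockwise circle integral (1/(2πi))² ∮_{|z₂|=ε₂} ∮_{|z₁|=ε₁} (z₂ − z₁)·f(z₁,z₂) / (z₁^N·(z₂^N − u·z₁^N)) dz₁ dz₂ is independent of u; i.e., it equals its value at u = 0, namely (1/(2πi))² ∮_{|z₂|=ε₂} ∮_{|z₁|=ε₁} (z₂ − z₁)·f(z₁,z₂) / (z₁^N·z₂^N) dz₁ dz₂. -/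

import Mathlib

open MvPolynomial

theorem stmt_1 (N : ℕ) (hN : 1 ≤ N) (f : MvPolynomial (Fin 2) ℂ)
    (ε₁ ε₂ : ℝ) (hε₁ : 0 < ε₁) (hε : ε₁ < ε₂)
    (u : ℂ) (hu : ‖u‖ * ε₁ ^ N < ε₂ ^ N) :
    (1 / (2 * (Real.pi : ℂ) * Complex.I)) ^ 2 *
      (∮ z₂ in C(0, ε₂), ∮ z₁ in C(0, ε₁),
        (z₂ - z₁) * eval ![z₁, z₂] f / (z₁ ^ N * (z₂ ^ N - u * z₁ ^ N))) =
    (1 / (2 * (Real.pi : ℂ) * Complex.I)) ^ 2 *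
      (∮ z₂ in C(0, ε₂), ∮ z₁ in C(0, ε₁),
        (z₂ - z₁) * eval ![z₁, z₂] f / (z₁ ^ N * z₂ ^ N)) := by
  congr 1
  have hε₂ : 0 < ε₂ := hε₁.trans hε
  refine circleIntegral.integral_congr hε₂.le ?_
  intro z₂ hz₂
  have hz₂n : ‖z₂‖ = ε₂ := by simpa using hz₂
  have hz₂0 : z₂ ≠ 0 := by
    intro h; rw [h, norm_zero] at hz₂n; exact hε₂.ne hz₂n
  -- the difference of the integrands is holomorphic in z₁ on the closed disc
  have hden : ∀ z : ℂ, ‖z‖ ≤ ε₁ → z₂ ^ N - u * z ^ N ≠ 0 := by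
    intro z hz h
    have h1 : ‖z₂ ^ N‖ = ‖u * z ^ N‖ := by rw [sub_eq_zero.mp h]
    rw [norm_mul, norm_pow, norm_pow, hz₂n] at h1
    have h2 : ‖u‖ * ‖z‖ ^ N ≤ ‖u‖ * ε₁ ^ N := by gcongr
    linarith
  have hf : Differentiable ℂ (fun z : ℂ => eval ![z, z₂] f) := by
    induction f using MvPolynomial.induction_on with
    | C a => simp
    | add p q hp hq => simp only [map_add]; exact hp.add hq
    | mul_X p i hp =>
      simp only [map_mul, eval_X]
      refine hp.mul ?_
      fin_cases i <;> simp
  have hfc := hf.continuous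
  have hz0 : ∀ z ∈ Metric.sphere (0 : ℂ) ε₁, z ≠ 0 := by
    intro z hz h
    have : ‖z‖ = ε₁ := by simpa using hz
    rw [h, norm_zero] at this; exact hε₁.ne this
  have hzn : ∀ z ∈ Metric.sphere (0 : ℂ) ε₁, ‖z‖ ≤ ε₁ := by
    intro z hz
    have : ‖z‖ = ε₁ := by simpa using hz
    exact this.le
  have hI1 : CircleIntegrable
      (fun z₁ => (z₂ - z₁) * eval ![z₁, z₂] f / (z₁ ^ N * (z₂ ^ N - u * z₁ ^ N))) 0 ε₁ := by
    refine ContinuousOn.circleIntegrable hε₁.le (ContinuousOn.div ?_ ?_ ?_)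
    · exact Continuous.continuousOn ((continuous_const.sub continuous_id).mul hfc)
    · fun_prop
    · intro z hz
      exact mul_ne_zero (pow_ne_zero _ (hz0 z hz)) (hden z (hzn z hz))
  have hI2 : CircleIntegrable
      (fun z₁ => (z₂ - z₁) * eval ![z₁, z₂] f / (z₁ ^ N * z₂ ^ N)) 0 ε₁ := by
    refine ContinuousOn.circleIntegrable hε₁.le (ContinuousOn.div ?_ ?_ ?_)
    · exact Continuous.continuousOn ((continuous_const.sub continuous_id).mul hfc)
    · fun_prop
    · intro z hz
      exact mul_ne_zero (pow_ne_zero _ (hz0 z hz)) (pow_ne_zero _ hz₂0)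
  have hC : (∮ z₁ in C(0, ε₁),
      (z₂ - z₁) * eval ![z₁, z₂] f * u / (z₂ ^ N * (z₂ ^ N - u * z₁ ^ N))) = 0 := by
    refine DiffContOnCl.circleIntegral_eq_zero hε₁.le (DifferentiableOn.diffContOnCl ?_)
    rw [closure_ball _ hε₁.ne']
    refine DifferentiableOn.div ?_ ?_ ?_
    · exact Differentiable.differentiableOn
        ((((differentiable_const z₂).sub differentiable_id).mul hf).mul (differentiable_const u))
    · fun_prop
    · intro z hz
      exact mul_ne_zero (pow_ne_zero _ hz₂0) (hden z (by simpa using hz))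
  show circleIntegral _ _ _ = circleIntegral _ _ _
  rw [← sub_eq_zero, ← circleIntegral.integral_sub hI1 hI2]
  refine Eq.trans ?_ hC
  refine circleIntegral.integral_congr hε₁.le ?_
  intro z hz
  have h1 := pow_ne_zero N (hz0 z hz)
  have h2 := pow_ne_zero N hz₂0
  have h3 := hden z (hzn z hz)
  beta_reduce
  generalize z ^ N = a at h1 h2 h3 ⊢
  generalize z₂ ^ N = b at h1 h2 h3 ⊢
  obtain ⟨c, hc⟩ : ∃ c, c = b - u * a := ⟨_, rfl⟩
  rw [← hc] at h3 ⊢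
  have hb : b = c + u * a := by rw [hc]; ring
  field_simp
  rw [hb]
  ring
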